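/- arXiv:2502.06479 — 4 statements merged into one kernel-verified Lean document; each statement's English description precedes it below -/
import Mathlib

section
/- Let f : ℝⁿ → ℝ be locally Lipschitz continuous, and assume that for every u ∈ ℝⁿ and every x ∈ ℝⁿ the cone K_x(u) = ⋃_{λ ≥ 0} (λ·∂f(u) × {λ·(f(x) − f(u))}) is a closed subset of ℝⁿ × ℝ. Then f is invex if and only if every stationary point of f (i.e., every u ∈ ℝⁿ with 0 ∈ ∂f(u)) is a global minimum of f over ℝⁿ. -/
open Filter Set RealInnerProductSpace

/-- Clarke's generalized directional derivative of `f` at `u` in direction `d`. -/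
noncomputable def clarkeDeriv {n : ℕ} (f : EuclideanSpace ℝ (Fin n) → ℝ)
    (u d : EuclideanSpace ℝ (Fin n)) : ℝ :=
  Filter.limsup (fun p : EuclideanSpace ℝ (Fin n) × ℝ => (f (p.1 + p.2 • d) - f p.1) / p.2)
    ((nhds u) ×ˢ (nhdsWithin 0 (Set.Ioi (0:ℝ))))

/-- Clarke's subdifferential of `f` at `u`. -/
noncomputable def clarkeSubdiff {n : ℕ} (f : EuclideanSpace ℝ (Fin n) → ℝ)
    (u : EuclideanSpace ℝ (Fin n)) : Set (EuclideanSpace ℝ (Fin n)) :=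
  {ξ | ∀ d, ⟪ξ, d⟫ ≤ clarkeDeriv f u d}

/-- The cone `K_x(u) = ⋃_{λ ≥ 0} (λ·∂f(u) × {λ·(f(x) − f(u))})`. -/
noncomputable def clarkeCone {n : ℕ} (f : EuclideanSpace ℝ (Fin n) → ℝ)
    (x u : EuclideanSpace ℝ (Fin n)) : Set (EuclideanSpace ℝ (Fin n) × ℝ) :=
  {q | ∃ l : ℝ, 0 ≤ l ∧ ∃ ξ ∈ clarkeSubdiff f u, q = (l • ξ, l * (f x - f u))}

theorem convex_clarkeSubdiff {n : ℕ} (f : EuclideanSpace ℝ (Fin n) → ℝ)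
    (u : EuclideanSpace ℝ (Fin n)) : Convex ℝ (clarkeSubdiff f u) := by
  intro ξ hξ ζ hζ a b ha hb hab d
  rw [inner_add_left, real_inner_smul_left, real_inner_smul_left]
  calc a * ⟪ξ, d⟫ + b * ⟪ζ, d⟫ ≤ a * clarkeDeriv f u d + b * clarkeDeriv f u d :=
        add_le_add (mul_le_mul_of_nonneg_left (hξ d) ha) (mul_le_mul_of_nonneg_left (hζ d) hb)
    _ = clarkeDeriv f u d := by rw [← add_mul, hab, one_mul]

theorem smul_mem_clarkeCone {n : ℕ} {f : EuclideanSpace ℝ (Fin n) → ℝ}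
    {x u : EuclideanSpace ℝ (Fin n)} {q : EuclideanSpace ℝ (Fin n) × ℝ}
    (hq : q ∈ clarkeCone f x u) {a : ℝ} (ha : 0 ≤ a) : a • q ∈ clarkeCone f x u := by
  obtain ⟨l, hl, ξ, hξ, rfl⟩ := hq
  exact ⟨a * l, mul_nonneg ha hl, ξ, hξ, by simp [smul_smul, mul_assoc]⟩

theorem add_mem_clarkeCone {n : ℕ} {f : EuclideanSpace ℝ (Fin n) → ℝ}
    {x u : EuclideanSpace ℝ (Fin n)} {p q : EuclideanSpace ℝ (Fin n) × ℝ}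
    (hp : p ∈ clarkeCone f x u) (hq : q ∈ clarkeCone f x u) : p + q ∈ clarkeCone f x u := by
  obtain ⟨l, hl, ξ, hξ, rfl⟩ := hp
  obtain ⟨m, hm, ζ, hζ, rfl⟩ := hq
  rcases (add_nonneg hl hm).eq_or_lt with h | h
  · obtain rfl : l = 0 := by linarith
    obtain rfl : m = 0 := by linarith
    exact ⟨0, le_rfl, ξ, hξ, by simp⟩
  · refine ⟨l + m, h.le, (l / (l + m)) • ξ + (m / (l + m)) • ζ,
      convex_clarkeSubdiff f u hξ hζ (div_nonneg hl h.le) (div_nonneg hm h.le)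
        (by rw [← add_div, div_self h.ne']), ?_⟩
    rw [smul_add, smul_smul, smul_smul, mul_div_cancel₀ _ h.ne', mul_div_cancel₀ _ h.ne',
      Prod.mk_add_mk, add_mul]

theorem convex_clarkeCone {n : ℕ} (f : EuclideanSpace ℝ (Fin n) → ℝ)
    (x u : EuclideanSpace ℝ (Fin n)) : Convex ℝ (clarkeCone f x u) :=
  fun _ hp _ hq _ _ ha hb _ =>
    add_mem_clarkeCone (smul_mem_clarkeCone hp ha) (smul_mem_clarkeCone hq hb)

/-- If the cone is closed and misses `(0, -1)`, the invexity inequality at `u` is solvable. -/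
theorem exists_inner_le_of_notMem_clarkeCone {n : ℕ} {f : EuclideanSpace ℝ (Fin n) → ℝ}
    {x u : EuclideanSpace ℝ (Fin n)} (hK : IsClosed (clarkeCone f x u))
    (hx : ((0 : EuclideanSpace ℝ (Fin n)), (-1 : ℝ)) ∉ clarkeCone f x u) :
    ∃ v : EuclideanSpace ℝ (Fin n), ∀ ξ ∈ clarkeSubdiff f u, f x - f u ≥ ⟪ξ, v⟫ := by
  rcases (clarkeSubdiff f u).eq_empty_or_nonempty with hC | ⟨ξ₀, hξ₀⟩
  · exact ⟨0, by simp [hC]⟩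
  obtain ⟨g, r, hg, hr⟩ := geometric_hahn_banach_closed_point (convex_clarkeCone f x u) hK hx
  have hr0 : 0 < r := by
    simpa using hg 0 ⟨0, le_rfl, ξ₀, hξ₀, by simp [Prod.zero_eq_mk]⟩
  have hs : 0 < g (0, -1) := hr0.trans hr
  have hle : ∀ ξ ∈ clarkeSubdiff f u, g (ξ, f x - f u) ≤ 0 := by
    intro ξ hξ
    by_contra! hpos
    have h := hg _ (smul_mem_clarkeCone (f := f) (x := x) (u := u)
      (q := (ξ, f x - f u)) ⟨1, zero_le_one, ξ, hξ, by simp⟩ (div_pos hr0 hpos).le)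
    rw [map_smul, smul_eq_mul, div_mul_cancel₀ _ hpos.ne'] at h
    exact lt_irrefl _ h
  set w := (InnerProductSpace.toDual ℝ (EuclideanSpace ℝ (Fin n))).symm
    (g.comp (ContinuousLinearMap.inl ℝ (EuclideanSpace ℝ (Fin n)) ℝ)) with hw
  refine ⟨(g (0, -1))⁻¹ • w, fun ξ hξ => ?_⟩
  have hinner : ⟪ξ, w⟫ = g (ξ, 0) := by
    rw [real_inner_comm, hw, InnerProductSpace.toDual_symm_apply]
    simp
  have hsplit : g (ξ, f x - f u) = g (ξ, 0) - (f x - f u) * g (0, -1) := by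
    rw [← smul_eq_mul, ← map_smul, ← map_sub]
    simp
  rw [real_inner_smul_right, hinner, ge_iff_le, inv_mul_le_iff₀ hs]
  linarith [hle ξ hξ]

theorem stmt1 {n : ℕ} (f : EuclideanSpace ℝ (Fin n) → ℝ) (hf : LocallyLipschitz f)
    (hK : ∀ u x : EuclideanSpace ℝ (Fin n), IsClosed (clarkeCone f x u)) :
    (∃ η : EuclideanSpace ℝ (Fin n) × EuclideanSpace ℝ (Fin n) → EuclideanSpace ℝ (Fin n),
      ∀ x u : EuclideanSpace ℝ (Fin n), ∀ ξ ∈ clarkeSubdiff f u, f x - f u ≥ ⟪ξ, η (x, u)⟫) ↔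
    (∀ u : EuclideanSpace ℝ (Fin n), (0 : EuclideanSpace ℝ (Fin n)) ∈ clarkeSubdiff f u →
      ∀ x : EuclideanSpace ℝ (Fin n), f u ≤ f x) := by
  constructor
  · rintro ⟨η, hη⟩ u hu x
    simpa using hη x u 0 hu
  · intro hmin
    have hsolve : ∀ p : EuclideanSpace ℝ (Fin n) × EuclideanSpace ℝ (Fin n),
        ∃ v : EuclideanSpace ℝ (Fin n), ∀ ξ ∈ clarkeSubdiff f p.2, f p.1 - f p.2 ≥ ⟪ξ, v⟫ := by
      rintro ⟨x, u⟩
      refine exists_inner_le_of_notMem_clarkeCone (hK u x) ?_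
      rintro ⟨l, hl, ξ, hξ, h⟩
      obtain ⟨h₁, h₂⟩ := Prod.ext_iff.mp h
      dsimp only at h₁ h₂
      rcases smul_eq_zero.mp h₁.symm with rfl | rfl
      · norm_num at h₂
      · have := mul_nonneg hl (sub_nonneg.mpr (hmin u hξ x))
        linarith
    choose η hη using hsolve
    exact ⟨η, fun x u => hη (x, u)⟩
end

section
/- Let f₁, …, f_p : ℝⁿ → ℝ be everywhere differentiable. The following statements are equivalent: (i) there exists η : ℝⁿ × ℝⁿ → ℝⁿ such that for all i and all x, u ∈ ℝⁿ, fᵢ(x) − fᵢ(u) ≥ ⟨∇fᵢ(u), η(x, u)⟩ (the fᵢ are invex with respect to the same η); (ii) there exists η : ℝⁿ × ℝⁿ → ℝⁿ such that for all i and all x, u ∈ ℝⁿ, fᵢ(x) − fᵢ(u) ≥ ⟨∇fᵢ(u), η(x, u)⟩, and moreover for every λ ∈ ℝ^p with λᵢ ≥ 0, ∑ᵢ λᵢ fᵢ(x) − ∑ᵢ λᵢ fᵢ(u) ≥ ⟨∇(∑ᵢ λᵢ fᵢ)(u), η(x, u)⟩ for all x, u; (iii) for every λ ∈ ℝ^p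 with λᵢ ≥ 0 there exists η_λ : ℝⁿ × ℝⁿ → ℝⁿ such that ∑ᵢ λᵢ fᵢ(x) − ∑ᵢ λᵢ fᵢ(u) ≥ ⟨∇(∑ᵢ λᵢ fᵢ)(u), η_λ(x, u)⟩ for all x, u; (iv) for every λ ∈ ℝ^p with λᵢ ≥ 0, every u ∈ ℝⁿ with ∇(∑ᵢ λᵢ fᵢ)(u) = 0 is a global minimum of ∑ᵢ λᵢ fᵢ over ℝⁿ. -/
open Filter Set RealInnerProductSpace

/-- Algebraic **Farkas lemma**: a linear functional that is nonpositive wherever finitely many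
functionals are nonpositive is a nonnegative combination of them. -/
theorem exists_nonneg_sum_smul_eq_of_forall_nonpos {W : Type*} [AddCommGroup W] [Module ℝ W]
    {p : ℕ} (a : Fin p → W →ₗ[ℝ] ℝ) (b : W →ₗ[ℝ] ℝ)
    (h : ∀ x, (∀ i, a i x ≤ 0) → b x ≤ 0) :
    ∃ c : Fin p → ℝ, (∀ i, 0 ≤ c i) ∧ ∀ x, b x = ∑ i, c i * a i x := by
  induction p generalizing b with
  | zero =>
    refine ⟨fun _ => 0, fun _ => le_rfl, fun x => ?_⟩
    have h₁ := h x (fun i => i.elim0)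
    have h₂ := h (-x) (fun i => i.elim0)
    rw [map_neg] at h₂
    simp only [Finset.univ_eq_empty, Finset.sum_empty]
    linarith
  | succ p ih =>
    by_cases hb : ∀ x, (∀ i : Fin p, a i.succ x ≤ 0) → b x ≤ 0
    · obtain ⟨c, hc, hbc⟩ := ih (fun i => a i.succ) b hb
      refine ⟨Fin.cons 0 c, fun i => ?_, fun x => ?_⟩
      · refine Fin.cases ?_ (fun j => ?_) i
        · simp
        · simpa using hc j
      · simp [Fin.sum_univ_succ, hbc x]
    · push Not at hb
      obtain ⟨z, hz, hbz⟩ := hb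
      have haz : 0 < a 0 z := by
        by_contra! hle
        exact hbz.not_ge (h z (Fin.cases hle hz))
      obtain ⟨c, hc, hbc⟩ := ih (fun i => a i.succ - (a i.succ z / a 0 z) • a 0)
        (b - (b z / a 0 z) • a 0) (fun x hx => by
          have hy : ∀ i, a i (x - (a 0 x / a 0 z) • z) ≤ 0 := by
            refine Fin.cases ?_ fun i => ?_
            · simp [haz.ne']
            · have hxi := hx i
              simp only [map_sub, map_smul, smul_eq_mul, LinearMap.sub_apply,
                LinearMap.smul_apply] at hxi ⊢
              calc a i.succ x - a 0 x / a 0 z * a i.succ z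
                  = a i.succ x - a i.succ z / a 0 z * a 0 x := by ring
                _ ≤ 0 := hxi
          have hby := h _ hy
          simp only [map_sub, map_smul, smul_eq_mul, LinearMap.sub_apply,
            LinearMap.smul_apply] at hby ⊢
          calc b x - b z / a 0 z * a 0 x = b x - a 0 x / a 0 z * b z := by ring
            _ ≤ 0 := hby)
      refine ⟨Fin.cons (b z / a 0 z - ∑ i, c i * (a i.succ z / a 0 z)) c, fun i => ?_,
        fun x => ?_⟩
      · refine Fin.cases ?_ (fun j => ?_) i
        · have hsum : ∑ i, c i * (a i.succ z / a 0 z) ≤ 0 :=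
            Finset.sum_nonpos fun i _ => mul_nonpos_of_nonneg_of_nonpos (hc i)
              (div_nonpos_of_nonpos_of_nonneg (hz i) haz.le)
          have hquot : 0 < b z / a 0 z := div_pos hbz haz
          simp only [Fin.cons_zero]
          linarith
        · simpa using hc j
      · have hx := hbc x
        simp only [LinearMap.sub_apply, LinearMap.smul_apply, smul_eq_mul, mul_sub,
          Finset.sum_sub_distrib, ← mul_assoc, ← Finset.sum_mul] at hx
        simp only [Fin.sum_univ_succ, Fin.cons_zero, Fin.cons_succ, sub_mul]
        linarith

/-- **Gale's theorem of the alternative** for a finite system of linear inequalities. -/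
theorem exists_forall_inner_le_of_forall_nonneg {E : Type*} [NormedAddCommGroup E]
    [InnerProductSpace ℝ E] {p : ℕ} (a : Fin p → E) (b : Fin p → ℝ)
    (h : ∀ c : Fin p → ℝ, (∀ i, 0 ≤ c i) → ∑ i, c i • a i = 0 → 0 ≤ ∑ i, c i * b i) :
    ∃ y : E, ∀ i, ⟪a i, y⟫ ≤ b i := by
  by_contra! hno
  obtain ⟨c, hc, hsum⟩ := exists_nonneg_sum_smul_eq_of_forall_nonpos
    (fun i => (innerₛₗ ℝ (a i)).comp (LinearMap.fst ℝ E ℝ) - b i • LinearMap.snd ℝ E ℝ)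
    (LinearMap.snd ℝ E ℝ) (fun x hx => by
      by_contra! ht
      simp only [LinearMap.snd_apply] at ht
      obtain ⟨i, hi⟩ := hno (x.2⁻¹ • x.1)
      have hxi := hx i
      simp only [LinearMap.sub_apply, LinearMap.comp_apply, LinearMap.fst_apply,
        innerₛₗ_apply_apply, LinearMap.smul_apply, LinearMap.snd_apply, smul_eq_mul] at hxi
      rw [real_inner_smul_right, lt_inv_mul_iff₀ ht] at hi
      linarith)
  have hzero : ∑ i, c i • a i = 0 := by
    refine ext_inner_right ℝ fun y => ?_
    have hy := hsum (y, 0)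
    simp at hy
    simp [sum_inner, real_inner_smul_left, ← hy]
  have hone := hsum (0, 1)
  simp at hone
  linarith [h c hc hzero]

/-- The gradient of a finite linear combination of differentiable functions. -/
theorem gradient_sum_mul {E ι : Type*} [NormedAddCommGroup E] [InnerProductSpace ℝ E]
    [CompleteSpace E] [Fintype ι] {f : ι → E → ℝ} {u : E}
    (hf : ∀ i, DifferentiableAt ℝ (f i) u) (c : ι → ℝ) :
    gradient (fun y => ∑ i, c i * f i y) u = ∑ i, c i • gradient (f i) u := by
  have hderiv : HasFDerivAt (fun y => ∑ i, c i * f i y) (∑ i, c i • fderiv ℝ (f i) u) u :=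
    HasFDerivAt.fun_sum fun i _ => (hf i).hasFDerivAt.const_mul (c i)
  simp [gradient, hderiv.fderiv]

theorem stmt4 {n p : ℕ} (f : Fin p → EuclideanSpace ℝ (Fin n) → ℝ)
    (hdiff : ∀ (i : Fin p) (u : EuclideanSpace ℝ (Fin n)), DifferentiableAt ℝ (f i) u) :
    ((∃ η : EuclideanSpace ℝ (Fin n) × EuclideanSpace ℝ (Fin n) → EuclideanSpace ℝ (Fin n),
        ∀ (i : Fin p) (x u : EuclideanSpace ℝ (Fin n)),
          f i x - f i u ≥ ⟪gradient (f i) u, η (x, u)⟫) ↔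
      (∃ η : EuclideanSpace ℝ (Fin n) × EuclideanSpace ℝ (Fin n) → EuclideanSpace ℝ (Fin n),
        (∀ (i : Fin p) (x u : EuclideanSpace ℝ (Fin n)),
          f i x - f i u ≥ ⟪gradient (f i) u, η (x, u)⟫) ∧
        (∀ lam : Fin p → ℝ, (∀ i, 0 ≤ lam i) →
          ∀ x u : EuclideanSpace ℝ (Fin n),
            (∑ i, lam i * f i x) - (∑ i, lam i * f i u) ≥
              ⟪gradient (fun y => ∑ i, lam i * f i y) u, η (x, u)⟫))) ∧
    ((∃ η : EuclideanSpace ℝ (Fin n) × EuclideanSpace ℝ (Fin n) → EuclideanSpace ℝ (Fin n),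
        (∀ (i : Fin p) (x u : EuclideanSpace ℝ (Fin n)),
          f i x - f i u ≥ ⟪gradient (f i) u, η (x, u)⟫) ∧
        (∀ lam : Fin p → ℝ, (∀ i, 0 ≤ lam i) →
          ∀ x u : EuclideanSpace ℝ (Fin n),
            (∑ i, lam i * f i x) - (∑ i, lam i * f i u) ≥
              ⟪gradient (fun y => ∑ i, lam i * f i y) u, η (x, u)⟫)) ↔
      (∀ lam : Fin p → ℝ, (∀ i, 0 ≤ lam i) →
        ∃ ηl : EuclideanSpace ℝ (Fin n) × EuclideanSpace ℝ (Fin n) → EuclideanSpace ℝ (Fin n),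
          ∀ x u : EuclideanSpace ℝ (Fin n),
            (∑ i, lam i * f i x) - (∑ i, lam i * f i u) ≥
              ⟪gradient (fun y => ∑ i, lam i * f i y) u, ηl (x, u)⟫)) ∧
    ((∀ lam : Fin p → ℝ, (∀ i, 0 ≤ lam i) →
        ∃ ηl : EuclideanSpace ℝ (Fin n) × EuclideanSpace ℝ (Fin n) → EuclideanSpace ℝ (Fin n),
          ∀ x u : EuclideanSpace ℝ (Fin n),
            (∑ i, lam i * f i x) - (∑ i, lam i * f i u) ≥
              ⟪gradient (fun y => ∑ i, lam i * f i y) u, ηl (x, u)⟫) ↔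
      (∀ lam : Fin p → ℝ, (∀ i, 0 ≤ lam i) →
        ∀ u : EuclideanSpace ℝ (Fin n),
          gradient (fun y => ∑ i, lam i * f i y) u = 0 →
          ∀ x : EuclideanSpace ℝ (Fin n), (∑ i, lam i * f i u) ≤ ∑ i, lam i * f i x)) := by
  have combine : ∀ η : EuclideanSpace ℝ (Fin n) × EuclideanSpace ℝ (Fin n) →
      EuclideanSpace ℝ (Fin n),
      (∀ (i : Fin p) (x u : EuclideanSpace ℝ (Fin n)),
        f i x - f i u ≥ ⟪gradient (f i) u, η (x, u)⟫) →
      ∀ lam : Fin p → ℝ, (∀ i, 0 ≤ lam i) → ∀ x u : EuclideanSpace ℝ (Fin n),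
        (∑ i, lam i * f i x) - (∑ i, lam i * f i u) ≥
          ⟪gradient (fun y => ∑ i, lam i * f i y) u, η (x, u)⟫ := by
    intro η hη lam hlam x u
    rw [gradient_sum_mul (fun i => hdiff i u), sum_inner, ← Finset.sum_sub_distrib]
    refine Finset.sum_le_sum fun i _ => ?_
    rw [real_inner_smul_left, ← mul_sub]
    exact mul_le_mul_of_nonneg_left (hη i x u) (hlam i)
  have minimum_of_invex : (∀ lam : Fin p → ℝ, (∀ i, 0 ≤ lam i) →
        ∃ ηl : EuclideanSpace ℝ (Fin n) × EuclideanSpace ℝ (Fin n) → EuclideanSpace ℝ (Fin n),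
          ∀ x u : EuclideanSpace ℝ (Fin n),
            (∑ i, lam i * f i x) - (∑ i, lam i * f i u) ≥
              ⟪gradient (fun y => ∑ i, lam i * f i y) u, ηl (x, u)⟫) →
      ∀ lam : Fin p → ℝ, (∀ i, 0 ≤ lam i) → ∀ u : EuclideanSpace ℝ (Fin n),
        gradient (fun y => ∑ i, lam i * f i y) u = 0 →
        ∀ x : EuclideanSpace ℝ (Fin n), (∑ i, lam i * f i u) ≤ ∑ i, lam i * f i x := by
    intro h lam hlam u hu x
    obtain ⟨ηl, hηl⟩ := h lam hlam
    have hx := hηl x u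
    rw [hu, inner_zero_left] at hx
    linarith
  have invex_of_minimum : (∀ lam : Fin p → ℝ, (∀ i, 0 ≤ lam i) →
        ∀ u : EuclideanSpace ℝ (Fin n), gradient (fun y => ∑ i, lam i * f i y) u = 0 →
        ∀ x : EuclideanSpace ℝ (Fin n), (∑ i, lam i * f i u) ≤ ∑ i, lam i * f i x) →
      ∃ η : EuclideanSpace ℝ (Fin n) × EuclideanSpace ℝ (Fin n) → EuclideanSpace ℝ (Fin n),
        ∀ (i : Fin p) (x u : EuclideanSpace ℝ (Fin n)),
          f i x - f i u ≥ ⟪gradient (f i) u, η (x, u)⟫ := by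
    intro h
    have hex : ∀ q : EuclideanSpace ℝ (Fin n) × EuclideanSpace ℝ (Fin n),
        ∃ y : EuclideanSpace ℝ (Fin n),
          ∀ i, ⟪gradient (f i) q.2, y⟫ ≤ f i q.1 - f i q.2 := by
      intro q
      refine exists_forall_inner_le_of_forall_nonneg _ _ fun c hc hzero => ?_
      rw [← gradient_sum_mul (fun i => hdiff i q.2)] at hzero
      simp only [mul_sub, Finset.sum_sub_distrib]
      exact sub_nonneg.mpr (h c hc q.2 hzero q.1)
    choose η hη using hex
    exact ⟨η, fun i x u => hη (x, u) i⟩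
  refine ⟨⟨fun ⟨η, hη⟩ => ⟨η, hη, combine η hη⟩, fun ⟨η, hη, _⟩ => ⟨η, hη⟩⟩,
    ⟨fun ⟨η, _, hη⟩ lam hlam => ⟨η, hη lam hlam⟩, fun h => ?_⟩,
    ⟨minimum_of_invex, fun h lam hlam => ?_⟩⟩
  · obtain ⟨η, hη⟩ := invex_of_minimum (minimum_of_invex h)
    exact ⟨η, hη, combine η hη⟩
  · obtain ⟨η, hη⟩ := invex_of_minimum h
    exact ⟨η, combine η hη lam hlam⟩
end

section
/- Define f₁ : ℝ → ℝ by f₁(x) = x·sin(ln x) + x·cos(ln x) + 5x for x > 0 and f₁(x) = 6x for x ≤ 0. Then f₁ is locally Lipschitz continuous and its Clarke subdifferential at 0 is ∂f₁(0) = [3, 7]. -/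
open Filter Set

/-- Clarke's generalized directional derivative of `f : ℝ → ℝ` at `u` in direction `d`. -/
noncomputable def clarkeDeriv1 (f : ℝ → ℝ) (u d : ℝ) : ℝ :=
  Filter.limsup (fun p : ℝ × ℝ => (f (p.1 + p.2 * d) - f p.1) / p.2)
    ((nhds u) ×ˢ (nhdsWithin 0 (Set.Ioi (0:ℝ))))

/-- Clarke's subdifferential of `f : ℝ → ℝ` at `u`. -/
noncomputable def clarkeSubdiff1 (f : ℝ → ℝ) (u : ℝ) : Set ℝ :=
  {ξ | ∀ d, ξ * d ≤ clarkeDeriv1 f u d}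

/-- The example function `f₁`. -/
noncomputable def f₁ : ℝ → ℝ := fun x =>
  if 0 < x then x * Real.sin (Real.log x) + x * Real.cos (Real.log x) + 5 * x else 6 * x

/-- The example function `f₂`. -/
noncomputable def f₂ : ℝ → ℝ := fun x => 3 * |x|

theorem f₁_hasDerivAt {x : ℝ} (hx : 0 < x) :
    HasDerivAt f₁ (2 * Real.cos (Real.log x) + 5) x := by
  have hlog := Real.hasDerivAt_log hx.ne'
  have hid := hasDerivAt_id x
  have h := ((hid.mul hlog.sin).add (hid.mul hlog.cos)).add (hid.const_mul 5)
  have heq : f₁ =ᶠ[nhds x]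
      fun x => x * Real.sin (Real.log x) + x * Real.cos (Real.log x) + 5 * x := by
    filter_upwards [Ioi_mem_nhds hx] with z hz
    exact if_pos hz
  refine HasDerivAt.congr_of_eventuallyEq (h.congr_deriv ?_) heq
  simp only [id]
  field_simp
  ring

/-- The increments of `f₁` lie between those of `3 * x` and `7 * x`. -/
theorem f₁_sub_mem_Icc {x y : ℝ} (hxy : x ≤ y) :
    f₁ y - f₁ x ∈ Icc (3 * (y - x)) (7 * (y - x)) := by
  rcases lt_or_ge 0 x with hx | hx
  · have hd : ∀ z ∈ Ioi (0 : ℝ), HasDerivAt f₁ (2 * Real.cos (Real.log z) + 5) z :=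
      fun z hz => f₁_hasDerivAt hz
    have hc : ContinuousOn f₁ (Ioi 0) :=
      fun z hz => (hd z hz).continuousAt.continuousWithinAt
    have hdiff : DifferentiableOn ℝ f₁ (interior (Ioi 0)) := by
      rw [interior_Ioi]
      exact fun z hz => (hd z hz).differentiableAt.differentiableWithinAt
    constructor
    · refine (convex_Ioi 0).mul_sub_le_image_sub_of_le_deriv hc hdiff ?_ x hx y
        (hx.trans_le hxy) hxy
      intro z hz
      rw [interior_Ioi] at hz
      rw [(hd z hz).deriv]
      linarith [Real.neg_one_le_cos (Real.log z)]
    · refine (convex_Ioi 0).image_sub_le_mul_sub_of_deriv_le hc hdiff ?_ x hx y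
        (hx.trans_le hxy) hxy
      intro z hz
      rw [interior_Ioi] at hz
      rw [(hd z hz).deriv]
      linarith [Real.cos_le_one (Real.log z)]
  · have hfx : f₁ x = 6 * x := if_neg hx.not_gt
    rcases lt_or_ge 0 y with hy | hy
    · have hfy : f₁ y = y * Real.sin (Real.log y) + y * Real.cos (Real.log y) + 5 * y := if_pos hy
      rw [hfx, hfy]
      constructor
      · nlinarith [mul_le_mul_of_nonneg_left (Real.neg_one_le_cos (Real.log y)) hy.le,
          mul_le_mul_of_nonneg_left (Real.neg_one_le_sin (Real.log y)) hy.le]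
      · nlinarith [mul_le_mul_of_nonneg_left (Real.cos_le_one (Real.log y)) hy.le,
          mul_le_mul_of_nonneg_left (Real.sin_le_one (Real.log y)) hy.le]
    · have hfy : f₁ y = 6 * y := if_neg hy.not_gt
      rw [hfx, hfy]
      constructor <;> linarith

theorem f₁_lipschitzWith : LipschitzWith 7 f₁ := by
  refine LipschitzWith.of_le_add_mul 7 fun x y => ?_
  rw [Real.dist_eq, NNReal.coe_ofNat]
  rcases le_total x y with h | h
  · have := (f₁_sub_mem_Icc h).1
    linarith [abs_nonneg (x - y)]
  · have := (f₁_sub_mem_Icc h).2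
    linarith [le_abs_self (x - y)]

theorem f₁_quotient_le_of_nonneg {d t : ℝ} (hd : 0 ≤ d) (ht : 0 < t) (y : ℝ) :
    (f₁ (y + t * d) - f₁ y) / t ≤ 7 * d := by
  have := (f₁_sub_mem_Icc (x := y) (y := y + t * d) (by nlinarith [mul_nonneg ht.le hd])).2
  rw [div_le_iff₀ ht]
  linarith

theorem f₁_quotient_le_of_nonpos {d t : ℝ} (hd : d ≤ 0) (ht : 0 < t) (y : ℝ) :
    (f₁ (y + t * d) - f₁ y) / t ≤ 3 * d := by
  have := (f₁_sub_mem_Icc (x := y + t * d) (y := y)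
    (by nlinarith [mul_nonneg ht.le (neg_nonneg.2 hd)])).1
  rw [div_le_iff₀ ht]
  linarith

theorem eventually_snd_pos (u : ℝ) :
    ∀ᶠ p : ℝ × ℝ in nhds u ×ˢ nhdsWithin 0 (Ioi (0 : ℝ)), 0 < p.2 :=
  tendsto_snd.eventually self_mem_nhdsWithin

theorem abs_quotient_le {f : ℝ → ℝ} {K : NNReal} (hf : LipschitzWith K f) {t : ℝ} (ht : 0 < t)
    (y d : ℝ) : |(f (y + t * d) - f y) / t| ≤ K * |d| := by
  have h := hf.dist_le_mul (y + t * d) y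
  rw [Real.dist_eq, Real.dist_eq, add_sub_cancel_left, abs_mul, abs_of_pos ht] at h
  rw [abs_div, abs_of_pos ht, div_le_iff₀ ht]
  linarith

theorem clarkeDeriv1_le {f : ℝ → ℝ} {K : NNReal} (hf : LipschitzWith K f) {u d a : ℝ}
    (h : ∀ y t : ℝ, 0 < t → (f (y + t * d) - f y) / t ≤ a) : clarkeDeriv1 f u d ≤ a := by
  refine limsup_le_of_le ?_ ((eventually_snd_pos u).mono fun p hp => h p.1 p.2 hp)
  refine IsBoundedUnder.isCoboundedUnder_le ⟨-(K * |d|), ?_⟩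
  rw [eventually_map]
  exact (eventually_snd_pos u).mono fun p hp => (abs_le.1 (abs_quotient_le hf hp p.1 d)).1

/-- Derivatives of `f` at points accumulating at `u` bound Clarke's derivative from below. -/
theorem le_clarkeDeriv1 {f : ℝ → ℝ} {K : NNReal} (hf : LipschitzWith K f) {u c : ℝ}
    (h : ∃ᶠ y in nhds u, HasDerivAt f c y) (d : ℝ) : c * d ≤ clarkeDeriv1 f u d := by
  refine le_of_forall_lt_imp_le_of_dense fun a ha => ?_
  refine le_limsup_of_frequently_le ?_ ⟨K * |d|, ?_⟩
  · intro hev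
    obtain ⟨y, hy, hlt⟩ := (h.and_eventually hev.curry).exists
    have hg : HasDerivAt (fun t => f (y + t * d)) (c * d) 0 := by
      have hin : HasDerivAt (fun t : ℝ => y + t * d) d 0 := by
        simpa using ((hasDerivAt_id (0 : ℝ)).mul_const d).const_add y
      exact HasDerivAt.comp (0 : ℝ) (by simpa using hy) hin
    have ht := hg.tendsto_slope_zero_right
    refine ha.not_ge (le_of_tendsto ht (hlt.mono fun t ht => ?_))
    have := (not_le.1 ht).le
    simpa [div_eq_inv_mul] using this
  · rw [eventually_map]
    exact (eventually_snd_pos u).mono fun p hp => (abs_le.1 (abs_quotient_le hf hp p.1 d)).2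

theorem frequently_hasDerivAt_f₁ (θ : ℝ) :
    ∃ᶠ y in nhds (0 : ℝ), HasDerivAt f₁ (2 * Real.cos θ + 5) y := by
  have hlim : Tendsto (fun n : ℕ => Real.exp (θ - n * (2 * Real.pi))) atTop (nhds 0) := by
    refine Real.tendsto_exp_atBot.comp ?_
    simp only [sub_eq_add_neg]
    refine tendsto_atBot_add_const_left _ _ (tendsto_neg_atTop_atBot.comp ?_)
    exact tendsto_natCast_atTop_atTop.atTop_mul_const Real.two_pi_pos
  refine hlim.frequently (Frequently.of_forall fun n => ?_)
  have h := f₁_hasDerivAt (Real.exp_pos (θ - n * (2 * Real.pi)))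
  rwa [Real.log_exp, Real.cos_sub_nat_mul_two_pi] at h

theorem stmt6 : LocallyLipschitz f₁ ∧ clarkeSubdiff1 f₁ 0 = Set.Icc (3 : ℝ) 7 := by
  refine ⟨f₁_lipschitzWith.locallyLipschitz, Set.ext fun ξ => ⟨fun h => ⟨?_, ?_⟩, fun h d => ?_⟩⟩
  · have h1 := (h (-1)).trans (clarkeDeriv1_le f₁_lipschitzWith
      fun y t ht => f₁_quotient_le_of_nonpos (by norm_num) ht y)
    linarith
  · have h1 := (h 1).trans (clarkeDeriv1_le f₁_lipschitzWith
      fun y t ht => f₁_quotient_le_of_nonneg (by norm_num) ht y)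
    linarith
  · rcases le_total 0 d with hd | hd
    · refine le_trans ?_ (le_clarkeDeriv1 f₁_lipschitzWith (frequently_hasDerivAt_f₁ 0) d)
      rw [Real.cos_zero]
      nlinarith [mul_le_mul_of_nonneg_right h.2 hd]
    · refine le_trans ?_ (le_clarkeDeriv1 f₁_lipschitzWith (frequently_hasDerivAt_f₁ Real.pi) d)
      rw [Real.cos_pi]
      nlinarith [mul_le_mul_of_nonpos_right h.1 hd]
end

section
/- Let f : ℝⁿ → ℝ be everywhere differentiable. Then f is invex (i.e., there exists η : ℝⁿ × ℝⁿ → ℝⁿ with f(x) − f(u) ≥ ⟨∇f(u), η(x, u)⟩ for all x, u ∈ ℝⁿ) if and only if every stationary point is a global minimum, i.e., for every u ∈ ℝⁿ with ∇f(u) = 0 one has f(u) ≤ f(x) for all x ∈ ℝⁿ. -/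
open Filter Set RealInnerProductSpace

theorem stmt10 {n : ℕ} (f : EuclideanSpace ℝ (Fin n) → ℝ)
    (hdiff : ∀ u : EuclideanSpace ℝ (Fin n), DifferentiableAt ℝ f u) :
    (∃ η : EuclideanSpace ℝ (Fin n) × EuclideanSpace ℝ (Fin n) → EuclideanSpace ℝ (Fin n),
      ∀ x u : EuclideanSpace ℝ (Fin n), f x - f u ≥ ⟪gradient f u, η (x, u)⟫) ↔
    (∀ u : EuclideanSpace ℝ (Fin n), gradient f u = 0 →
      ∀ x : EuclideanSpace ℝ (Fin n), f u ≤ f x) := by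
  constructor
  · rintro ⟨η, hη⟩ u hu x
    have h := hη x u
    rw [hu, inner_zero_left] at h
    linarith
  · intro h
    refine ⟨fun p => ((f p.1 - f p.2) / ⟪gradient f p.2, gradient f p.2⟫) • gradient f p.2,
      fun x u => ?_⟩
    by_cases hu : gradient f u = 0
    · rw [hu, inner_zero_left]
      linarith [h u hu x]
    · rw [inner_smul_right, div_mul_cancel₀ _ (inner_self_ne_zero.mpr hu)]
end
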